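/- Let d ≥ 1 and 0 < t < d. There is a constant C = C(t,d) such that for every measurable set U ⊆ 𝕋^d one has I_t(U) ≤ C · λ(U)^{2 − t/d}. -/

import Mathlib

open MeasureTheory Filter
open scoped ENNReal

noncomputable section

/-- The `d`-dimensional torus `ℝ^d/ℤ^d`, with its Haar probability measure `volume`. -/
abbrev Torus (d : ℕ) : Type := Fin d → AddCircle (1 : ℝ)

/-- The `t`-energy `I_t(A) = ∬_{A×A} dist(x,y)^{-t} dλ(x) dλ(y)` of a set `A ⊆ 𝕋^d`. -/
def energy {d : ℕ} (t : ℝ) (A : Set (Torus d)) : ℝ≥0∞ :=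
  ∫⁻ x in A, ∫⁻ y in A, edist x y ^ (-t) ∂volume ∂volume

/-- A closed ball of radius `s` in the torus has measure at most `(2 s) ^ d`. -/
lemma Torus.volume_closedBall_le {d : ℕ} (x : Torus d) {s : ℝ} (hs : 0 ≤ s) :
    volume (Metric.closedBall x s) ≤ ENNReal.ofReal ((2 * s) ^ d) := by
  rw [closedBall_pi _ hs, volume_pi_pi, ENNReal.ofReal_pow (by positivity)]
  calc ∏ i, volume (Metric.closedBall (x i) s)
      ≤ ∏ _i : Fin d, ENNReal.ofReal (2 * s) := by
        refine Finset.prod_le_prod' fun i _ => ?_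
        rw [AddCircle.volume_closedBall]
        exact ENNReal.ofReal_le_ofReal (min_le_right _ _)
    _ = ENNReal.ofReal (2 * s) ^ d := by simp

/-- Dyadic majorant of the Riesz kernel at scale `r`. -/
lemma edist_rpow_neg_le_dyadic {X : Type*} [PseudoMetricSpace X] {t r : ℝ} (ht : 0 < t)
    (hr : 0 < r) (x y : X) :
    edist x y ^ (-t) ≤ ENNReal.ofReal (r ^ (-t)) +
      ∑' k : ℕ, (Metric.closedBall x (r * (1 / 2) ^ k)).indicator
        (fun _ => ENNReal.ofReal ((r * (1 / 2) ^ (k + 1)) ^ (-t))) y := by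
  rcases (dist_nonneg (x := x) (y := y)).eq_or_lt with h0 | hpos
  · suffices h : ∑' k : ℕ, (Metric.closedBall x (r * (1 / 2) ^ k)).indicator
        (fun _ => ENNReal.ofReal ((r * (1 / 2) ^ (k + 1)) ^ (-t))) y = ⊤ by
      rw [h]; simp
    refine top_unique ?_
    rw [← ENNReal.tsum_const_eq_top_of_ne_zero (α := ℕ) (c := ENNReal.ofReal (r ^ (-t)))
      (by simpa using Real.rpow_pos_of_pos hr (-t))]
    refine ENNReal.tsum_le_tsum fun k => ?_
    have hy : y ∈ Metric.closedBall x (r * (1 / 2) ^ k) := by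
      rw [Metric.mem_closedBall', ← h0]; positivity
    rw [Set.indicator_of_mem hy]
    refine ENNReal.ofReal_le_ofReal (Real.rpow_le_rpow_of_nonpos (by positivity) ?_ (by linarith))
    exact mul_le_of_le_one_right hr.le (pow_le_one₀ (by norm_num) (by norm_num))
  · rw [edist_dist, ENNReal.ofReal_rpow_of_pos hpos]
    rcases le_total r (dist x y) with h | h
    · exact le_add_right (ENNReal.ofReal_le_ofReal
        (Real.rpow_le_rpow_of_nonpos hr h (by linarith)))
    · obtain ⟨k, hk1, hk2⟩ := exists_nat_pow_near_of_lt_one (div_pos hpos hr)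
        ((div_le_one hr).2 h) (by norm_num : (0 : ℝ) < 1 / 2) (by norm_num)
      rw [lt_div_iff₀' hr] at hk1
      rw [div_le_iff₀' hr] at hk2
      refine le_add_left (le_trans ?_ (ENNReal.le_tsum k))
      rw [Set.indicator_of_mem (Metric.mem_closedBall'.2 hk2)]
      exact ENNReal.ofReal_le_ofReal
        (Real.rpow_le_rpow_of_nonpos (by positivity) hk1.le (by linarith))

/-- The potential of a set `U`, estimated by splitting the kernel at scale `r`. -/
lemma Torus.setLIntegral_edist_rpow_neg_le {d : ℕ} {t r : ℝ} (ht : 0 < t) (hr : 0 < r)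
    (x : Torus d) (U : Set (Torus d)) :
    ∫⁻ y in U, edist x y ^ (-t) ≤ ENNReal.ofReal (r ^ (-t)) * volume U +
      ENNReal.ofReal (2 ^ (d + t)) * (1 - ENNReal.ofReal ((1 / 2) ^ (d - t)))⁻¹ *
        ENNReal.ofReal (r ^ (d - t)) := by
  have hterm (k : ℕ) : (r * (1 / 2) ^ (k + 1)) ^ (-t) * (2 * (r * (1 / 2) ^ k)) ^ d
      = 2 ^ (d + t) * ((1 / 2) ^ (d - t)) ^ k * r ^ (d - t) := by
    have h2 : (1 / 2 : ℝ) = 2 ^ (-1 : ℝ) := by rw [Real.rpow_neg_one]; norm_num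
    rw [h2, ← Real.rpow_natCast _ d]
    simp only [← Real.rpow_natCast, ← Real.rpow_mul zero_le_two]
    rw [Real.mul_rpow hr.le (by positivity), Real.mul_rpow zero_le_two (by positivity),
      Real.mul_rpow hr.le (by positivity), ← Real.rpow_mul zero_le_two,
      ← Real.rpow_mul zero_le_two]
    rw [show (d : ℝ) - t = -t + d by ring, Real.rpow_add hr]
    have : (2 : ℝ) ^ (d + t) * 2 ^ (-1 * (-t + d) * k)
        = 2 ^ (-1 * ((k + 1 : ℕ) : ℝ) * -t) * 2 ^ (d : ℝ) * 2 ^ (-1 * (k : ℝ) * d) := by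
      simp only [← Real.rpow_add zero_lt_two]
      congr 1; push_cast; ring
    rw [this]; ring
  calc ∫⁻ y in U, edist x y ^ (-t)
      ≤ ∫⁻ y in U, (ENNReal.ofReal (r ^ (-t)) +
          ∑' k : ℕ, (Metric.closedBall x (r * (1 / 2) ^ k)).indicator
            (fun _ => ENNReal.ofReal ((r * (1 / 2) ^ (k + 1)) ^ (-t))) y) :=
        lintegral_mono fun y => edist_rpow_neg_le_dyadic ht hr x y
    _ = ENNReal.ofReal (r ^ (-t)) * volume U + ∑' k : ℕ,
          ENNReal.ofReal ((r * (1 / 2) ^ (k + 1)) ^ (-t)) *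
            volume.restrict U (Metric.closedBall x (r * (1 / 2) ^ k)) := by
        rw [lintegral_add_left measurable_const, setLIntegral_const, lintegral_tsum fun k =>
          (measurable_const.indicator measurableSet_closedBall).aemeasurable]
        simp_rw [lintegral_indicator_const measurableSet_closedBall]
    _ ≤ ENNReal.ofReal (r ^ (-t)) * volume U + ∑' k : ℕ,
          ENNReal.ofReal (2 ^ (d + t)) * ENNReal.ofReal ((1 / 2) ^ (d - t)) ^ k *
            ENNReal.ofReal (r ^ (d - t)) := by
        refine add_le_add_right (ENNReal.tsum_le_tsum fun k => ?_) _
        rw [← ENNReal.ofReal_pow (by positivity), ← ENNReal.ofReal_mul (by positivity),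
          ← ENNReal.ofReal_mul (by positivity), ← hterm, ENNReal.ofReal_mul (by positivity)]
        gcongr
        exact (Measure.restrict_apply_le _ _).trans
          (Torus.volume_closedBall_le x (by positivity))
    _ = _ := by rw [ENNReal.tsum_mul_right, ENNReal.tsum_mul_left, ENNReal.tsum_geometric]

/-- Energy estimate by comparison with a ball of the same measure: there is a constant
`C = C(t,d)` such that `I_t(U) ≤ C · λ(U)^{2 - t/d}` for every measurable `U ⊆ 𝕋^d`. -/
theorem energy_le_const_mul_volume_rpow
    (d : ℕ) (hd : 1 ≤ d) (t : ℝ) (ht0 : 0 < t) (htd : t < d) :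
    ∃ C : ℝ≥0∞, C ≠ ⊤ ∧ ∀ U : Set (Torus d), MeasurableSet U →
      energy t U ≤ C * (volume U) ^ (2 - t / d) := by
  have hd0 : (0 : ℝ) < d := by exact_mod_cast hd
  set K : ℝ≥0∞ := ENNReal.ofReal (2 ^ (d + t)) * (1 - ENNReal.ofReal ((1 / 2) ^ (d - t)))⁻¹
    with hK
  have ha : ENNReal.ofReal ((1 / 2) ^ (d - t)) < 1 :=
    ENNReal.ofReal_lt_one.2 (Real.rpow_lt_one (by norm_num) (by norm_num) (by linarith))
  refine ⟨1 + K, ?_, fun U _ => ?_⟩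
  · exact ENNReal.add_ne_top.2 ⟨ENNReal.one_ne_top, ENNReal.mul_ne_top ENNReal.ofReal_ne_top
      (ENNReal.inv_ne_top.2 (tsub_pos_of_lt ha).ne')⟩
  rcases eq_or_ne (volume U) 0 with h0 | h0
  · simp [energy, Measure.restrict_eq_zero.2 h0]
  have htop : volume U ≠ ⊤ := measure_ne_top _ _
  have hm : 0 < (volume U).toReal := ENNReal.toReal_pos h0 htop
  have hr : 0 < (volume U).toReal ^ (1 / d : ℝ) := Real.rpow_pos_of_pos hm _
  have hrpow (s : ℝ) : ENNReal.ofReal (((volume U).toReal ^ (1 / d : ℝ)) ^ s)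
      = volume U ^ (s / d) := by
    rw [← Real.rpow_mul hm.le, ← ENNReal.ofReal_rpow_of_pos hm, ENNReal.ofReal_toReal htop,
      one_div_mul_eq_div]
  have hadd (a b : ℝ) (hab : a + 1 = b) : volume U ^ a * volume U = volume U ^ b := by
    rw [← hab, ENNReal.rpow_add _ _ h0 htop, ENNReal.rpow_one]
  calc energy t U ≤ ∫⁻ _ in U, (1 + K) * volume U ^ (1 - t / d) := by
        refine lintegral_mono fun x => ?_
        refine (Torus.setLIntegral_edist_rpow_neg_le ht0 hr x U).trans_eq ?_
        rw [hrpow, hrpow, hadd _ (1 - t / d) (by ring), ← hK, add_mul, one_mul, sub_div,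
          div_self hd0.ne']
    _ = (1 + K) * volume U ^ (2 - t / d) := by
        rw [setLIntegral_const, mul_assoc, hadd _ (2 - t / d) (by ring)]
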